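/- arXiv:2011.09349 — 4 statements merged into one kernel-verified Lean document; each statement's English description precedes it below -/
import Mathlib

section
/- Under the boundedness/continuity assumption and the universal approximation assumption, the optimal network values converge to the optimal value: lim_{k→∞} inf_{θ∈O_k} v(Φ(·;θ)) = v* = inf_{a∈𝒞} v(a). -/
open Filter Topology MeasureTheory

namespace Overlearning

/-- The component `z_t`, `t = 0,…,T`, of a trajectory `z = (z₁,…,z_T) ∈ 𝒵^T`,
with the convention `z₀ = 0`. -/
def zAt {q T : ℕ} (z : Fin T → (Fin q → ℝ)) (t : ℕ) : Fin q → ℝ :=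
  if h : 1 ≤ t ∧ t ≤ T then z ⟨t - 1, by omega⟩ else 0

/-- The controlled state `x^a_t(z)` with dynamics `f`, initial state `x0`,
feedback action `a`, on the trajectory `z`. -/
def state {p q mdim T : ℕ}
    (f : ℕ → (Fin p → ℝ) → (Fin q → ℝ) → (Fin mdim → ℝ) → (Fin p → ℝ))
    (x0 : Fin p → ℝ)
    (a : ℕ → (Fin p → ℝ) → (Fin q → ℝ) → (Fin mdim → ℝ))
    (z : Fin T → (Fin q → ℝ)) : ℕ → (Fin p → ℝ)
  | 0 => x0
  | t + 1 => f t (state f x0 a z t) (zAt z (t + 1)) (a t (state f x0 a z t) (zAt z t))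

/-- The pathwise cost `ℓ(a,z)`. -/
noncomputable def pathCost {p q mdim T : ℕ}
    (f : ℕ → (Fin p → ℝ) → (Fin q → ℝ) → (Fin mdim → ℝ) → (Fin p → ℝ))
    (x0 : Fin p → ℝ)
    (ψ : ℕ → (Fin p → ℝ) → (Fin mdim → ℝ) → ℝ) (φ : (Fin p → ℝ) → ℝ)
    (a : ℕ → (Fin p → ℝ) → (Fin q → ℝ) → (Fin mdim → ℝ))
    (z : Fin T → (Fin q → ℝ)) : ℝ :=
  (∑ t ∈ Finset.range T, ψ t (state f x0 a z t) (a t (state f x0 a z t) (zAt z t)))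
    + φ (state f x0 a z T)

/-- `a` is a feedback action: on each time slice `t ∈ 𝒯 = {0,…,T-1}` it is
a continuous function of `(x, ζ)` with values in the control set `A`. -/
def IsAction {p q mdim : ℕ} (T : ℕ) (A : Set (Fin mdim → ℝ))
    (a : ℕ → (Fin p → ℝ) → (Fin q → ℝ) → (Fin mdim → ℝ)) : Prop :=
  (∀ t, t < T → Continuous fun xz : (Fin p → ℝ) × (Fin q → ℝ) => a t xz.1 xz.2) ∧
  ∀ t, t < T → ∀ x ζ, a t x ζ ∈ A

/-- The empirical loss `L(a; L_n)` on the training set `Ls`. -/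
noncomputable def empLoss {p q mdim T n : ℕ}
    (f : ℕ → (Fin p → ℝ) → (Fin q → ℝ) → (Fin mdim → ℝ) → (Fin p → ℝ))
    (x0 : Fin p → ℝ)
    (ψ : ℕ → (Fin p → ℝ) → (Fin mdim → ℝ) → ℝ) (φ : (Fin p → ℝ) → ℝ)
    (a : ℕ → (Fin p → ℝ) → (Fin q → ℝ) → (Fin mdim → ℝ))
    (Ls : Fin n → (Fin T → (Fin q → ℝ))) : ℝ :=
  (n : ℝ)⁻¹ * ∑ i, pathCost f x0 ψ φ a (Ls i)

/-- Locally uniform convergence of a sequence of feedback actions,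
on each time slice `t ∈ 𝒯`. -/
def ActTendsto {p q mdim : ℕ} (T : ℕ)
    (aseq : ℕ → ℕ → (Fin p → ℝ) → (Fin q → ℝ) → (Fin mdim → ℝ))
    (a : ℕ → (Fin p → ℝ) → (Fin q → ℝ) → (Fin mdim → ℝ)) : Prop :=
  ∀ t, t < T → TendstoLocallyUniformly
    (fun k (xz : (Fin p → ℝ) × (Fin q → ℝ)) => aseq k t xz.1 xz.2)
    (fun xz => a t xz.1 xz.2) atTop

/-- Coordinatewise truncation of a vector to the cube `[-n, n]`. -/
noncomputable def clamp {ι : Type*} (n : ℕ) (x : ι → ℝ) : ι → ℝ :=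
  fun i => max (-(n : ℝ)) (min (n : ℝ) (x i))

theorem continuous_clamp {ι : Type*} (n : ℕ) : Continuous (clamp (ι := ι) n) := by
  unfold clamp
  fun_prop

theorem clamp_mem_Icc {ι : Type*} (n : ℕ) (x : ι → ℝ) :
    clamp n x ∈ Set.Icc (fun _ => -(n : ℝ)) (fun _ : ι => (n : ℝ)) := by
  have hn : (0 : ℝ) ≤ n := n.cast_nonneg
  exact ⟨fun i => le_max_left _ _, fun i => max_le (by linarith) (min_le_left _ _)⟩

theorem clamp_eq_self {ι : Type*} [Fintype ι] {n : ℕ} {x : ι → ℝ} (h : ‖x‖ ≤ n) :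
    clamp n x = x := by
  ext i
  have hi := abs_le.mp ((norm_le_pi_norm x i).trans h)
  simp [clamp, min_eq_right hi.2, max_eq_right hi.1]

section Truncation

variable {p q mdim T : ℕ} {A : Set (Fin mdim → ℝ)}
  {a : ℕ → (Fin p → ℝ) → (Fin q → ℝ) → (Fin mdim → ℝ)}

/-- Precomposing an action with a truncation of its arguments gives an action. -/
theorem IsAction.comp_clamp (ha : IsAction T A a) (n : ℕ) :
    IsAction T A (fun t x ζ => a t (clamp n x) (clamp n ζ)) :=
  ⟨fun t ht => (ha.1 t ht).comp ((continuous_clamp n).prodMap (continuous_clamp n)),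
    fun t ht _ _ => ha.2 t ht _ _⟩

theorem IsAction.isBounded_range_comp_clamp (ha : IsAction T A a) (n : ℕ) {t : ℕ} (ht : t < T) :
    Bornology.IsBounded (Set.range
      fun xz : (Fin p → ℝ) × (Fin q → ℝ) => a t (clamp n xz.1) (clamp n xz.2)) := by
  have hK : IsCompact (Set.Icc (fun _ : Fin p => -(n : ℝ)) (fun _ => (n : ℝ)) ×ˢ
      Set.Icc (fun _ : Fin q => -(n : ℝ)) (fun _ => (n : ℝ))) :=
    isCompact_Icc.prod isCompact_Icc
  refine (hK.image (ha.1 t ht)).isBounded.subset ?_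
  rintro _ ⟨xz, rfl⟩
  exact ⟨(clamp n xz.1, clamp n xz.2), ⟨clamp_mem_Icc n _, clamp_mem_Icc n _⟩, rfl⟩

variable (T a) in
theorem actTendsto_comp_clamp :
    ActTendsto T (fun n t x ζ => a t (clamp n x) (clamp n ζ)) a := by
  intro t _
  rw [Metric.tendstoLocallyUniformly_iff]
  intro ε hε w
  refine ⟨Metric.ball w 1, Metric.ball_mem_nhds w one_pos, ?_⟩
  obtain ⟨N, hN⟩ := exists_nat_ge (‖w‖ + 1)
  filter_upwards [eventually_ge_atTop N] with n hn y hy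
  have hy' : ‖y‖ ≤ n := by
    have hball : ‖y - w‖ < 1 := mem_ball_iff_norm.mp hy
    have hNn : (N : ℝ) ≤ n := by exact_mod_cast hn
    linarith [norm_sub_norm_le y w]
  rw [clamp_eq_self ((norm_fst_le y).trans hy'), clamp_eq_self ((norm_snd_le y).trans hy'),
    dist_self]
  exact hε

end Truncation

theorem network_values_tendsto_optimal_value
    {p q mdim T : ℕ} (hT : 1 ≤ T)
    (Zset : Set (Fin q → ℝ)) (hZclosed : IsClosed Zset) (h0Z : (0 : Fin q → ℝ) ∈ Zset)
    (A : Set (Fin mdim → ℝ)) (hAclosed : IsClosed A) (hAne : A.Nonempty)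
    (f : ℕ → (Fin p → ℝ) → (Fin q → ℝ) → (Fin mdim → ℝ) → (Fin p → ℝ))
    (hf : ∀ t, t < T → Continuous fun w : (Fin p → ℝ) × (Fin q → ℝ) × (Fin mdim → ℝ) =>
      f t w.1 w.2.1 w.2.2)
    (x0 : Fin p → ℝ)
    (ψ : ℕ → (Fin p → ℝ) → (Fin mdim → ℝ) → ℝ) (φ : (Fin p → ℝ) → ℝ)
    (hψcont : ∀ t, t < T → Continuous fun w : (Fin p → ℝ) × (Fin mdim → ℝ) => ψ t w.1 w.2)
    (hψbdd : ∃ C, ∀ t x g, |ψ t x g| ≤ C)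
    (hφcont : Continuous φ) (hφbdd : ∃ C, ∀ x, |φ x| ≤ C)
    (ν : Measure (Fin T → (Fin q → ℝ))) [IsProbabilityMeasure ν]
    (hνsupp : ∀ᵐ z ∂ν, ∀ i, z i ∈ Zset)
    (cstar : ℝ)
    (hbound : ∀ (a : ℕ → (Fin p → ℝ) → (Fin q → ℝ) → (Fin mdim → ℝ))
      (z : Fin T → (Fin q → ℝ)), IsAction T A a → (∀ i, z i ∈ Zset) →
      |pathCost f x0 ψ φ a z| ≤ cstar)
    (hcont : ∀ (aseq : ℕ → ℕ → (Fin p → ℝ) → (Fin q → ℝ) → (Fin mdim → ℝ))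
      (a : ℕ → (Fin p → ℝ) → (Fin q → ℝ) → (Fin mdim → ℝ)),
      (∀ k, IsAction T A (aseq k)) → IsAction T A a → ActTendsto T aseq a →
      (∀ z : Fin T → (Fin q → ℝ), Tendsto (fun k => pathCost f x0 ψ φ (aseq k) z) atTop
        (𝓝 (pathCost f x0 ψ φ a z))) ∧
      Tendsto (fun k => ∫ z, pathCost f x0 ψ φ (aseq k) z ∂ν) atTop
        (𝓝 (∫ z, pathCost f x0 ψ φ a z ∂ν)))
    (d : ℕ → ℕ) (O : (k : ℕ) → Set (Fin (d k) → ℝ))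
    (hOcomp : ∀ k, IsCompact (O k)) (hOne : ∀ k, (O k).Nonempty)
    (Φ : (k : ℕ) → (Fin (d k) → ℝ) → ℕ → (Fin p → ℝ) → (Fin q → ℝ) → (Fin mdim → ℝ))
    (hΦact : ∀ k, ∀ θ ∈ O k, IsAction T A (Φ k θ))
    (hΦcont : ∀ k, ∀ t, t < T → Continuous
      fun w : ((Fin p → ℝ) × (Fin q → ℝ)) × (Fin (d k) → ℝ) => Φ k w.2 t w.1.1 w.1.2)
    (hUA : ∀ a : ℕ → (Fin p → ℝ) → (Fin q → ℝ) → (Fin mdim → ℝ), IsAction T A a →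
      (∀ t, t < T → Bornology.IsBounded
        (Set.range fun xz : (Fin p → ℝ) × (Fin q → ℝ) => a t xz.1 xz.2)) →
      ∃ θ : (k : ℕ) → (Fin (d k) → ℝ), (∀ k, θ k ∈ O k) ∧
        ActTendsto T (fun k => Φ k (θ k)) a)
    : Tendsto (fun k => sInf {r : ℝ | ∃ θ ∈ O k, r = ∫ z, pathCost f x0 ψ φ (Φ k θ) z ∂ν})
      atTop (𝓝 (sInf {r : ℝ | ∃ a, IsAction T A a ∧ r = ∫ z, pathCost f x0 ψ φ a z ∂ν})) := by
  have hlower : ∀ a, IsAction T A a → -cstar ≤ ∫ z, pathCost f x0 ψ φ a z ∂ν := by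
    intro a ha
    have h : ‖∫ z, pathCost f x0 ψ φ a z ∂ν‖ ≤ cstar * ν.real Set.univ :=
      norm_integral_le_of_norm_le_const (hνsupp.mono fun z hz => hbound a z ha hz)
    simp only [probReal_univ, mul_one, Real.norm_eq_abs] at h
    exact (abs_le.mp h).1
  have hbdd : BddBelow {r : ℝ | ∃ a, IsAction T A a ∧ r = ∫ z, pathCost f x0 ψ φ a z ∂ν} := by
    refine ⟨-cstar, ?_⟩
    rintro _ ⟨a, ha, rfl⟩
    exact hlower a ha
  have hsub : ∀ k, {r : ℝ | ∃ θ ∈ O k, r = ∫ z, pathCost f x0 ψ φ (Φ k θ) z ∂ν} ⊆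
      {r : ℝ | ∃ a, IsAction T A a ∧ r = ∫ z, pathCost f x0 ψ φ a z ∂ν} := by
    rintro k _ ⟨θ, hθ, rfl⟩
    exact ⟨Φ k θ, hΦact k θ hθ, rfl⟩
  have hne : ∀ k, {r : ℝ | ∃ θ ∈ O k, r = ∫ z, pathCost f x0 ψ φ (Φ k θ) z ∂ν}.Nonempty :=
    fun k => (hOne k).elim fun θ hθ => ⟨_, θ, hθ, rfl⟩
  rw [tendsto_order]
  refine ⟨fun b hb => Eventually.of_forall fun k =>
    hb.trans_le (csInf_le_csInf hbdd (hne k) (hsub k)), fun b hb => ?_⟩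
  obtain ⟨_, ⟨a, ha, rfl⟩, hab⟩ := exists_lt_of_csInf_lt ((hne 0).mono (hsub 0)) hb
  obtain ⟨n, hn⟩ := ((hcont _ a (fun n => ha.comp_clamp n) ha
    (actTendsto_comp_clamp T a)).2.eventually_lt_const hab).exists
  obtain ⟨θ, hθ, hlim⟩ := hUA _ (ha.comp_clamp n) fun t ht => ha.isBounded_range_comp_clamp n ht
  filter_upwards [(hcont _ _ (fun k => hΦact k (θ k) (hθ k)) (ha.comp_clamp n)
    hlim).2.eventually_lt_const hn] with k hk
  exact (csInf_le (hbdd.mono (hsub k)) ⟨θ k, hθ k, rfl⟩).trans_lt hk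

end Overlearning
end

section
/- For every trajectory z ∈ 𝒵^T, the pointwise infimum of the cost over constant actions equals the infimum over all feedback actions: inf_{α∈𝒜^T} ℓ̂(α,z) = inf_{a∈𝒞} ℓ(a,z). -/
open Filter Topology MeasureTheory

namespace Overlearning

/-- A feedback action and the open-loop action replaying its controls along the
trajectory `z` produce the same states on `z`. -/
theorem state_openLoop {p q mdim T : ℕ}
    (f : ℕ → (Fin p → ℝ) → (Fin q → ℝ) → (Fin mdim → ℝ) → (Fin p → ℝ))
    (x0 : Fin p → ℝ)
    (a : ℕ → (Fin p → ℝ) → (Fin q → ℝ) → (Fin mdim → ℝ))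
    (z : Fin T → (Fin q → ℝ)) (t : ℕ) :
    state f x0 (fun s _ _ => a s (state f x0 a z s) (zAt z s)) z t = state f x0 a z t := by
  induction t with
  | zero => rfl
  | succ t ih => simp only [state, ih]

theorem pathCost_openLoop {p q mdim T : ℕ}
    (f : ℕ → (Fin p → ℝ) → (Fin q → ℝ) → (Fin mdim → ℝ) → (Fin p → ℝ))
    (x0 : Fin p → ℝ)
    (ψ : ℕ → (Fin p → ℝ) → (Fin mdim → ℝ) → ℝ) (φ : (Fin p → ℝ) → ℝ)
    (a : ℕ → (Fin p → ℝ) → (Fin q → ℝ) → (Fin mdim → ℝ))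
    (z : Fin T → (Fin q → ℝ)) :
    pathCost f x0 ψ φ (fun s _ _ => a s (state f x0 a z s) (zAt z s)) z
      = pathCost f x0 ψ φ a z := by
  simp only [pathCost, state_openLoop]

/-- A family of constant controls in `A` is a feedback action. -/
theorem isAction_const {p q mdim T : ℕ} {A : Set (Fin mdim → ℝ)}
    {α : ℕ → (Fin mdim → ℝ)} (hα : ∀ t, t < T → α t ∈ A) :
    IsAction (p := p) (q := q) T A (fun t _ _ => α t) :=
  ⟨fun _ _ => continuous_const, fun t ht _ _ => hα t ht⟩

theorem pointwise_inf_constant_eq_inf_feedback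
    {p q mdim T : ℕ} (hT : 1 ≤ T)
    (Zset : Set (Fin q → ℝ)) (hZclosed : IsClosed Zset) (h0Z : (0 : Fin q → ℝ) ∈ Zset)
    (A : Set (Fin mdim → ℝ)) (hAclosed : IsClosed A) (hAne : A.Nonempty)
    (f : ℕ → (Fin p → ℝ) → (Fin q → ℝ) → (Fin mdim → ℝ) → (Fin p → ℝ))
    (hf : ∀ t, t < T → Continuous fun w : (Fin p → ℝ) × (Fin q → ℝ) × (Fin mdim → ℝ) =>
      f t w.1 w.2.1 w.2.2)
    (x0 : Fin p → ℝ)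
    (ψ : ℕ → (Fin p → ℝ) → (Fin mdim → ℝ) → ℝ) (φ : (Fin p → ℝ) → ℝ)
    (hψcont : ∀ t, t < T → Continuous fun w : (Fin p → ℝ) × (Fin mdim → ℝ) => ψ t w.1 w.2)
    (hψbdd : ∃ C, ∀ t x g, |ψ t x g| ≤ C)
    (hφcont : Continuous φ) (hφbdd : ∃ C, ∀ x, |φ x| ≤ C)
    : ∀ z : Fin T → (Fin q → ℝ), (∀ i, z i ∈ Zset) →
    sInf {r : ℝ | ∃ α : ℕ → (Fin mdim → ℝ), (∀ t, t < T → α t ∈ A) ∧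
        r = pathCost f x0 ψ φ (fun t _ _ => α t) z}
      = sInf {r : ℝ | ∃ a, IsAction T A a ∧ r = pathCost f x0 ψ φ a z} := by
  intro z _
  congr 1
  ext r
  constructor
  · rintro ⟨α, hα, rfl⟩
    exact ⟨_, isAction_const hα, rfl⟩
  · rintro ⟨a, ha, rfl⟩
    exact ⟨fun t => a t (state f x0 a z t) (zAt z t), fun t ht => ha.2 t ht _ _,
      (pathCost_openLoop f x0 ψ φ a z).symm⟩

end Overlearning
end

section
/- Under the boundedness/continuity assumption and the universal approximation assumption, for every ε > 0 there exists k_ε such that for every k ≥ k_ε and every training set L_n, |v* − inf_{θ∈O_k} L(Φ(·;θ); L_n)| ≤ G_k(L_n) + ε, where G_k(L_n) := sup_{θ∈O_k} |v(Φ(·;θ)) − L(Φ(·;θ); L_n)|. -/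
open Filter Topology MeasureTheory

namespace Overlearning

/-- Coordinatewise truncation of a vector to the cube `[-R, R]^ι`. -/
def truncate {ι : Type*} (R : ℕ) (x : ι → ℝ) : ι → ℝ :=
  fun i => max (-(R : ℝ)) (min (x i) R)

lemma continuous_truncate {ι : Type*} (R : ℕ) :
    Continuous (truncate R : (ι → ℝ) → ι → ℝ) := by
  unfold truncate
  fun_prop

lemma norm_truncate_le {ι : Type*} [Fintype ι] (R : ℕ) (x : ι → ℝ) : ‖truncate R x‖ ≤ R := by
  have hR : (0 : ℝ) ≤ R := R.cast_nonneg
  refine (pi_norm_le_iff_of_nonneg hR).2 fun i => ?_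
  rw [Real.norm_eq_abs, abs_le]
  exact ⟨le_max_left _ _, max_le (by linarith) (min_le_right _ _)⟩

lemma truncate_eq_self {ι : Type*} [Fintype ι] {R : ℕ} {x : ι → ℝ} (hx : ‖x‖ ≤ R) :
    truncate R x = x := by
  funext i
  have hi := abs_le.1 ((norm_le_pi_norm x i).trans hx)
  simp only [truncate]
  rw [min_eq_left hi.2, max_eq_right hi.1]

section Truncation

variable {p q mdim T : ℕ} {A : Set (Fin mdim → ℝ)}
  {a : ℕ → (Fin p → ℝ) → (Fin q → ℝ) → (Fin mdim → ℝ)}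

lemma IsAction.truncate (ha : IsAction T A a) (R : ℕ) :
    IsAction T A fun t x ζ => a t (truncate R x) (truncate R ζ) :=
  ⟨fun t ht => (ha.1 t ht).comp (((continuous_truncate R).comp continuous_fst).prodMk
    ((continuous_truncate R).comp continuous_snd)), fun t ht _ _ => ha.2 t ht _ _⟩

lemma IsAction.isBounded_range_truncate (ha : IsAction T A a) (R t : ℕ) (ht : t < T) :
    Bornology.IsBounded (Set.range fun xz : (Fin p → ℝ) × (Fin q → ℝ) =>
      a t (Overlearning.truncate R xz.1) (Overlearning.truncate R xz.2)) := by
  refine ((((isCompact_closedBall (0 : Fin p → ℝ) R).prod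
    (isCompact_closedBall (0 : Fin q → ℝ) R)).image (ha.1 t ht)).isBounded).subset ?_
  rintro _ ⟨xz, rfl⟩
  exact ⟨(Overlearning.truncate R xz.1, Overlearning.truncate R xz.2),
    ⟨mem_closedBall_zero_iff.2 (norm_truncate_le R _),
      mem_closedBall_zero_iff.2 (norm_truncate_le R _)⟩, rfl⟩

lemma actTendsto_truncate (a : ℕ → (Fin p → ℝ) → (Fin q → ℝ) → (Fin mdim → ℝ)) :
    ActTendsto T (fun R t x ζ => a t (truncate R x) (truncate R ζ)) a := by
  intro t _ u hu x
  obtain ⟨N, hN⟩ := exists_nat_ge (‖x‖ + 1)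
  refine ⟨Metric.ball x 1, Metric.ball_mem_nhds x one_pos, ?_⟩
  filter_upwards [eventually_ge_atTop N] with R hR y hy
  have hyR : ‖y‖ ≤ R := by
    have h₁ : ‖y - x‖ < 1 := by rwa [← dist_eq_norm]
    have h₂ : ‖y‖ ≤ ‖x‖ + ‖y - x‖ := norm_le_norm_add_norm_sub' y x
    have h₃ : (N : ℝ) ≤ R := by exact_mod_cast hR
    linarith
  simp only [truncate_eq_self ((norm_fst_le y).trans hyR),
    truncate_eq_self ((norm_snd_le y).trans hyR)]
  exact refl_mem_uniformity hu

end Truncation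

lemma abs_inv_card_mul_sum_le {n : ℕ} {g : Fin n → ℝ} {c : ℝ} (hc : 0 ≤ c)
    (hg : ∀ i, |g i| ≤ c) : |(n : ℝ)⁻¹ * ∑ i, g i| ≤ c := by
  rcases n.eq_zero_or_pos with rfl | hn
  · simpa using hc
  have hn' : (0 : ℝ) < n := by exact_mod_cast hn
  rw [abs_mul, abs_of_pos (inv_pos.2 hn'), inv_mul_le_iff₀ hn']
  calc |∑ i, g i| ≤ ∑ i, |g i| := Finset.abs_sum_le_sum_abs _ _
    _ ≤ ∑ _i : Fin n, c := Finset.sum_le_sum fun i _ => hg i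
    _ = n * c := by simp

theorem insample_value_close_to_optimal_value
    {p q mdim T : ℕ} (hT : 1 ≤ T)
    (Zset : Set (Fin q → ℝ)) (hZclosed : IsClosed Zset) (h0Z : (0 : Fin q → ℝ) ∈ Zset)
    (A : Set (Fin mdim → ℝ)) (hAclosed : IsClosed A) (hAne : A.Nonempty)
    (f : ℕ → (Fin p → ℝ) → (Fin q → ℝ) → (Fin mdim → ℝ) → (Fin p → ℝ))
    (hf : ∀ t, t < T → Continuous fun w : (Fin p → ℝ) × (Fin q → ℝ) × (Fin mdim → ℝ) =>
      f t w.1 w.2.1 w.2.2)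
    (x0 : Fin p → ℝ)
    (ψ : ℕ → (Fin p → ℝ) → (Fin mdim → ℝ) → ℝ) (φ : (Fin p → ℝ) → ℝ)
    (hψcont : ∀ t, t < T → Continuous fun w : (Fin p → ℝ) × (Fin mdim → ℝ) => ψ t w.1 w.2)
    (hψbdd : ∃ C, ∀ t x g, |ψ t x g| ≤ C)
    (hφcont : Continuous φ) (hφbdd : ∃ C, ∀ x, |φ x| ≤ C)
    (ν : Measure (Fin T → (Fin q → ℝ))) [IsProbabilityMeasure ν]
    (hνsupp : ∀ᵐ z ∂ν, ∀ i, z i ∈ Zset)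
    (cstar : ℝ)
    (hbound : ∀ (a : ℕ → (Fin p → ℝ) → (Fin q → ℝ) → (Fin mdim → ℝ))
      (z : Fin T → (Fin q → ℝ)), IsAction T A a → (∀ i, z i ∈ Zset) →
      |pathCost f x0 ψ φ a z| ≤ cstar)
    (hcont : ∀ (aseq : ℕ → ℕ → (Fin p → ℝ) → (Fin q → ℝ) → (Fin mdim → ℝ))
      (a : ℕ → (Fin p → ℝ) → (Fin q → ℝ) → (Fin mdim → ℝ)),
      (∀ k, IsAction T A (aseq k)) → IsAction T A a → ActTendsto T aseq a →
      (∀ z : Fin T → (Fin q → ℝ), Tendsto (fun k => pathCost f x0 ψ φ (aseq k) z) atTop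
        (𝓝 (pathCost f x0 ψ φ a z))) ∧
      Tendsto (fun k => ∫ z, pathCost f x0 ψ φ (aseq k) z ∂ν) atTop
        (𝓝 (∫ z, pathCost f x0 ψ φ a z ∂ν)))
    (d : ℕ → ℕ) (O : (k : ℕ) → Set (Fin (d k) → ℝ))
    (hOcomp : ∀ k, IsCompact (O k)) (hOne : ∀ k, (O k).Nonempty)
    (Φ : (k : ℕ) → (Fin (d k) → ℝ) → ℕ → (Fin p → ℝ) → (Fin q → ℝ) → (Fin mdim → ℝ))
    (hΦact : ∀ k, ∀ θ ∈ O k, IsAction T A (Φ k θ))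
    (hΦcont : ∀ k, ∀ t, t < T → Continuous
      fun w : ((Fin p → ℝ) × (Fin q → ℝ)) × (Fin (d k) → ℝ) => Φ k w.2 t w.1.1 w.1.2)
    (hUA : ∀ a : ℕ → (Fin p → ℝ) → (Fin q → ℝ) → (Fin mdim → ℝ), IsAction T A a →
      (∀ t, t < T → Bornology.IsBounded
        (Set.range fun xz : (Fin p → ℝ) × (Fin q → ℝ) => a t xz.1 xz.2)) →
      ∃ θ : (k : ℕ) → (Fin (d k) → ℝ), (∀ k, θ k ∈ O k) ∧
        ActTendsto T (fun k => Φ k (θ k)) a)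
    : ∀ ε : ℝ, 0 < ε → ∃ kε : ℕ, ∀ k, kε ≤ k →
    ∀ (n : ℕ) (Ls : Fin n → (Fin T → (Fin q → ℝ))), (∀ i j, Ls i j ∈ Zset) →
    |sInf {r : ℝ | ∃ a, IsAction T A a ∧ r = ∫ z, pathCost f x0 ψ φ a z ∂ν}
        - sInf {r : ℝ | ∃ θ ∈ O k, r = empLoss f x0 ψ φ (Φ k θ) Ls}|
      ≤ sSup {r : ℝ | ∃ θ ∈ O k,
          r = |(∫ z, pathCost f x0 ψ φ (Φ k θ) z ∂ν) - empLoss f x0 ψ φ (Φ k θ) Ls|} + ε := by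
  set v : (ℕ → (Fin p → ℝ) → (Fin q → ℝ) → (Fin mdim → ℝ)) → ℝ :=
    fun a => ∫ z, pathCost f x0 ψ φ a z ∂ν
  have hvbound : ∀ a, IsAction T A a → |v a| ≤ cstar := fun a ha => by
    have h := norm_integral_le_of_norm_le_const (μ := ν) (f := pathCost f x0 ψ φ a) (C := cstar)
      (hνsupp.mono fun z hz => hbound a z ha hz)
    simpa using h
  obtain ⟨g₀, hg₀⟩ := hAne
  have haction₀ : IsAction T A fun (_ : ℕ) (_ : Fin p → ℝ) (_ : Fin q → ℝ) => g₀ :=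
    ⟨fun _ _ => continuous_const, fun _ _ _ _ => hg₀⟩
  have hcstar : 0 ≤ cstar := (abs_nonneg _).trans (hvbound _ haction₀)
  set V : Set ℝ := {r | ∃ a, IsAction T A a ∧ r = v a}
  have hVbdd : BddBelow V := ⟨-cstar, by
    rintro _ ⟨a, ha, rfl⟩
    exact (abs_le.1 (hvbound a ha)).1⟩
  intro ε hε
  obtain ⟨_, ⟨a, ha, rfl⟩, hav⟩ := Real.lt_sInf_add_pos (s := V) ⟨_, _, haction₀, rfl⟩ hε
  have htrunc := (hcont _ a (fun R => ha.truncate R) ha (actTendsto_truncate a)).2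
  obtain ⟨R, hR⟩ := (htrunc.eventually_lt_const hav).exists
  obtain ⟨θ, hθ, hθlim⟩ := hUA _ (ha.truncate R) (ha.isBounded_range_truncate R)
  have happrox := (hcont _ _ (fun k => hΦact k _ (hθ k)) (ha.truncate R) hθlim).2
  obtain ⟨kε, hkε⟩ := eventually_atTop.1 (happrox.eventually_lt_const hR)
  refine ⟨kε, fun k hk n Ls hLs => ?_⟩
  have hLbound : ∀ η ∈ O k, |empLoss f x0 ψ φ (Φ k η) Ls| ≤ cstar := fun η hη =>
    abs_inv_card_mul_sum_le hcstar fun i => hbound _ _ (hΦact k η hη) (hLs i)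
  have hgap : ∀ η ∈ O k, |v (Φ k η) - empLoss f x0 ψ φ (Φ k η) Ls| ≤
      sSup {r : ℝ | ∃ θ ∈ O k, r = |v (Φ k θ) - empLoss f x0 ψ φ (Φ k θ) Ls|} := by
    refine fun η hη => le_csSup ⟨cstar + cstar, ?_⟩ ⟨η, hη, rfl⟩
    rintro _ ⟨η', hη', rfl⟩
    exact (abs_sub _ _).trans (add_le_add (hvbound _ (hΦact k η' hη')) (hLbound η' hη'))
  have hlower : sInf V - sSup {r : ℝ | ∃ θ ∈ O k,
      r = |v (Φ k θ) - empLoss f x0 ψ φ (Φ k θ) Ls|} ≤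
        sInf {r : ℝ | ∃ θ ∈ O k, r = empLoss f x0 ψ φ (Φ k θ) Ls} := by
    refine le_csInf ⟨_, θ k, hθ k, rfl⟩ ?_
    rintro _ ⟨η, hη, rfl⟩
    have h₁ : sInf V ≤ v (Φ k η) := csInf_le hVbdd ⟨_, hΦact k η hη, rfl⟩
    have h₂ := (abs_le.1 (hgap η hη)).2
    linarith
  have hupper : sInf {r : ℝ | ∃ θ ∈ O k, r = empLoss f x0 ψ φ (Φ k θ) Ls} ≤
      empLoss f x0 ψ φ (Φ k (θ k)) Ls := by
    refine csInf_le ⟨-cstar, ?_⟩ ⟨θ k, hθ k, rfl⟩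
    rintro _ ⟨η, hη, rfl⟩
    exact (abs_le.1 (hLbound η hη)).1
  have hgapθ := (abs_le.1 (hgap (θ k) (hθ k))).1
  have hvθ : v (Φ k (θ k)) < sInf V + ε := hkε k hk
  rw [abs_le]
  constructor <;> linarith

end Overlearning
end

section
/- Under the boundedness/continuity assumption and the universal approximation assumption, for every ε > 0 there exists k_ε such that for every k ≥ k_ε, every training set L_n, and every minimizer θ*_{k,n} ∈ O_k of θ ↦ L(Φ(·;θ); L_n) over O_k, the average performance of the trained action satisfies |v* − v(Φ(·;θ*_{k,n}))| ≤ 2 G_k(L_n) + ε, where G_k(L_n) := sup_{θ∈O_k} |v(Φ(·;θ)) − L(Φ(·;θ); L_n)|. -/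
open Filter Topology MeasureTheory

namespace Overlearning

/-- The coordinatewise projection of `x` onto the cube `[-R, R]^ι`. -/
def clip {ι : Type*} (R : ℝ) (x : ι → ℝ) : ι → ℝ :=
  fun i => max (-R) (min R (x i))

lemma continuous_clip {ι : Type*} (R : ℝ) : Continuous (clip R : (ι → ℝ) → ι → ℝ) := by
  unfold clip
  fun_prop

lemma clip_mem_Icc {ι : Type*} {R : ℝ} (hR : 0 ≤ R) (x : ι → ℝ) :
    clip R x ∈ Set.Icc (fun _ => -R) (fun _ => R) :=
  ⟨fun _ => le_max_left _ _, fun _ => max_le (by linarith) (min_le_left _ _)⟩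

lemma clip_eq_self {ι : Type*} [Fintype ι] {R : ℝ} {x : ι → ℝ} (hx : ‖x‖ ≤ R) :
    clip R x = x := by
  funext i
  have h := abs_le.mp ((norm_le_pi_norm x i).trans hx)
  simp only [clip, min_eq_right h.2, max_eq_right h.1]

/-- The action obtained from `a` by clipping the state and the disturbance to cubes. -/
def truncAction {p q mdim : ℕ} (a : ℕ → (Fin p → ℝ) → (Fin q → ℝ) → (Fin mdim → ℝ)) (R : ℝ) :
    ℕ → (Fin p → ℝ) → (Fin q → ℝ) → (Fin mdim → ℝ) :=
  fun t x ζ => a t (clip R x) (clip R ζ)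

section truncAction

variable {p q mdim T : ℕ} {A : Set (Fin mdim → ℝ)}
  {a : ℕ → (Fin p → ℝ) → (Fin q → ℝ) → (Fin mdim → ℝ)}

lemma IsAction.trunc (ha : IsAction T A a) (R : ℝ) : IsAction T A (truncAction a R) :=
  ⟨fun t ht => (ha.1 t ht).comp
      (((continuous_clip R).comp continuous_fst).prodMk ((continuous_clip R).comp continuous_snd)),
    fun t ht _ _ => ha.2 t ht _ _⟩

lemma IsAction.isBounded_range_trunc (ha : IsAction T A a) {R : ℝ} (hR : 0 ≤ R)
    {t : ℕ} (ht : t < T) :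
    Bornology.IsBounded
      (Set.range fun xz : (Fin p → ℝ) × (Fin q → ℝ) => truncAction a R t xz.1 xz.2) := by
  refine (((isCompact_Icc (a := fun _ => -R) (b := fun _ => R)).prod
    (isCompact_Icc (a := fun _ => -R) (b := fun _ => R))).image (ha.1 t ht)).isBounded.subset ?_
  rintro _ ⟨xz, rfl⟩
  exact ⟨(clip R xz.1, clip R xz.2), ⟨clip_mem_Icc hR _, clip_mem_Icc hR _⟩, rfl⟩

lemma actTendsto_truncAction (a : ℕ → (Fin p → ℝ) → (Fin q → ℝ) → (Fin mdim → ℝ)) :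
    ActTendsto T (fun N : ℕ => truncAction a N) a := by
  intro t _ u hu xz
  refine ⟨Metric.ball xz 1, Metric.ball_mem_nhds _ one_pos, ?_⟩
  filter_upwards [eventually_ge_atTop ⌈‖xz‖ + 1⌉₊] with N hN y hy
  have hy' : ‖y‖ ≤ N := by
    have h := norm_le_norm_add_norm_sub' y xz
    rw [← dist_eq_norm] at h
    linarith [Nat.ceil_le.mp hN, Metric.mem_ball.mp hy]
  simp only [truncAction, clip_eq_self ((norm_fst_le y).trans hy'),
    clip_eq_self ((norm_snd_le y).trans hy')]
  exact refl_mem_uniformity hu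

end truncAction

/-- A minimizer of `g` over `S` minimizes `w` over `S` up to twice the uniform distance of
`w` and `g` on `S`. -/
lemma le_add_two_mul_sSup_of_minimizer {α : Type*} {S : Set α} {w g : α → ℝ} {c : ℝ}
    (hw : ∀ θ ∈ S, |w θ| ≤ c) (hg : ∀ θ ∈ S, |g θ| ≤ c)
    {s θ : α} (hs : s ∈ S) (hmin : ∀ θ ∈ S, g s ≤ g θ) (hθ : θ ∈ S) :
    w s ≤ w θ + 2 * sSup {r : ℝ | ∃ θ ∈ S, r = |w θ - g θ|} := by
  have hbdd : BddAbove {r : ℝ | ∃ θ ∈ S, r = |w θ - g θ|} := by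
    refine ⟨c + c, ?_⟩
    rintro _ ⟨θ, hθ, rfl⟩
    exact (abs_sub _ _).trans (add_le_add (hw θ hθ) (hg θ hθ))
  have h₁ := abs_le.mp (le_csSup hbdd ⟨s, hs, rfl⟩)
  have h₂ := abs_le.mp (le_csSup hbdd ⟨θ, hθ, rfl⟩)
  linarith [hmin θ hθ, h₁.2, h₂.1]

theorem average_performance_close_to_optimal_value
    {p q mdim T : ℕ} (hT : 1 ≤ T)
    (Zset : Set (Fin q → ℝ)) (hZclosed : IsClosed Zset) (h0Z : (0 : Fin q → ℝ) ∈ Zset)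
    (A : Set (Fin mdim → ℝ)) (hAclosed : IsClosed A) (hAne : A.Nonempty)
    (f : ℕ → (Fin p → ℝ) → (Fin q → ℝ) → (Fin mdim → ℝ) → (Fin p → ℝ))
    (hf : ∀ t, t < T → Continuous fun w : (Fin p → ℝ) × (Fin q → ℝ) × (Fin mdim → ℝ) =>
      f t w.1 w.2.1 w.2.2)
    (x0 : Fin p → ℝ)
    (ψ : ℕ → (Fin p → ℝ) → (Fin mdim → ℝ) → ℝ) (φ : (Fin p → ℝ) → ℝ)
    (hψcont : ∀ t, t < T → Continuous fun w : (Fin p → ℝ) × (Fin mdim → ℝ) => ψ t w.1 w.2)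
    (hψbdd : ∃ C, ∀ t x g, |ψ t x g| ≤ C)
    (hφcont : Continuous φ) (hφbdd : ∃ C, ∀ x, |φ x| ≤ C)
    (ν : Measure (Fin T → (Fin q → ℝ))) [IsProbabilityMeasure ν]
    (hνsupp : ∀ᵐ z ∂ν, ∀ i, z i ∈ Zset)
    (cstar : ℝ)
    (hbound : ∀ (a : ℕ → (Fin p → ℝ) → (Fin q → ℝ) → (Fin mdim → ℝ))
      (z : Fin T → (Fin q → ℝ)), IsAction T A a → (∀ i, z i ∈ Zset) →
      |pathCost f x0 ψ φ a z| ≤ cstar)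
    (hcont : ∀ (aseq : ℕ → ℕ → (Fin p → ℝ) → (Fin q → ℝ) → (Fin mdim → ℝ))
      (a : ℕ → (Fin p → ℝ) → (Fin q → ℝ) → (Fin mdim → ℝ)),
      (∀ k, IsAction T A (aseq k)) → IsAction T A a → ActTendsto T aseq a →
      (∀ z : Fin T → (Fin q → ℝ), Tendsto (fun k => pathCost f x0 ψ φ (aseq k) z) atTop
        (𝓝 (pathCost f x0 ψ φ a z))) ∧
      Tendsto (fun k => ∫ z, pathCost f x0 ψ φ (aseq k) z ∂ν) atTop
        (𝓝 (∫ z, pathCost f x0 ψ φ a z ∂ν)))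
    (d : ℕ → ℕ) (O : (k : ℕ) → Set (Fin (d k) → ℝ))
    (hOcomp : ∀ k, IsCompact (O k)) (hOne : ∀ k, (O k).Nonempty)
    (Φ : (k : ℕ) → (Fin (d k) → ℝ) → ℕ → (Fin p → ℝ) → (Fin q → ℝ) → (Fin mdim → ℝ))
    (hΦact : ∀ k, ∀ θ ∈ O k, IsAction T A (Φ k θ))
    (hΦcont : ∀ k, ∀ t, t < T → Continuous
      fun w : ((Fin p → ℝ) × (Fin q → ℝ)) × (Fin (d k) → ℝ) => Φ k w.2 t w.1.1 w.1.2)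
    (hUA : ∀ a : ℕ → (Fin p → ℝ) → (Fin q → ℝ) → (Fin mdim → ℝ), IsAction T A a →
      (∀ t, t < T → Bornology.IsBounded
        (Set.range fun xz : (Fin p → ℝ) × (Fin q → ℝ) => a t xz.1 xz.2)) →
      ∃ θ : (k : ℕ) → (Fin (d k) → ℝ), (∀ k, θ k ∈ O k) ∧
        ActTendsto T (fun k => Φ k (θ k)) a)
    : ∀ ε : ℝ, 0 < ε → ∃ kε : ℕ, ∀ k, kε ≤ k →
    ∀ (n : ℕ) (Ls : Fin n → (Fin T → (Fin q → ℝ))), (∀ i j, Ls i j ∈ Zset) →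
    ∀ θstar ∈ O k, (∀ θ ∈ O k, empLoss f x0 ψ φ (Φ k θstar) Ls ≤ empLoss f x0 ψ φ (Φ k θ) Ls) →
    |sInf {r : ℝ | ∃ a, IsAction T A a ∧ r = ∫ z, pathCost f x0 ψ φ a z ∂ν}
        - ∫ z, pathCost f x0 ψ φ (Φ k θstar) z ∂ν|
      ≤ 2 * sSup {r : ℝ | ∃ θ ∈ O k,
          r = |(∫ z, pathCost f x0 ψ φ (Φ k θ) z ∂ν) - empLoss f x0 ψ φ (Φ k θ) Ls|} + ε := by
  intro ε hε
  set v : (ℕ → (Fin p → ℝ) → (Fin q → ℝ) → (Fin mdim → ℝ)) → ℝ :=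
    fun a => ∫ z, pathCost f x0 ψ φ a z ∂ν with hv
  have hvbound : ∀ a, IsAction T A a → |v a| ≤ cstar := fun a ha => by
    simpa using norm_integral_le_of_norm_le_const (f := pathCost f x0 ψ φ a)
      (hνsupp.mono fun z hz => hbound a z ha hz)
  obtain ⟨g₀, hg₀⟩ := hAne
  have hconst : IsAction T A fun (_ : ℕ) (_ : Fin p → ℝ) (_ : Fin q → ℝ) => g₀ :=
    ⟨fun _ _ => continuous_const, fun _ _ _ _ => hg₀⟩
  have hcstar : 0 ≤ cstar := (abs_nonneg _).trans (hvbound _ hconst)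
  have hbelow : BddBelow {r : ℝ | ∃ a, IsAction T A a ∧ r = v a} := by
    refine ⟨-cstar, ?_⟩
    rintro _ ⟨a, ha, rfl⟩
    exact (abs_le.mp (hvbound a ha)).1
  obtain ⟨_, ⟨a, ha, rfl⟩, ha_lt⟩ := exists_lt_of_csInf_lt
    (s := {r : ℝ | ∃ a, IsAction T A a ∧ r = v a}) ⟨_, _, hconst, rfl⟩
    (lt_add_of_pos_right _ (by positivity : 0 < ε / 2))
  obtain ⟨N, hN⟩ := ((hcont _ a (fun N => ha.trunc N) ha
    (actTendsto_truncAction a)).2.eventually_lt_const ha_lt).exists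
  obtain ⟨θ, hθO, hθ⟩ := hUA _ (ha.trunc N)
    fun t ht => ha.isBounded_range_trunc N.cast_nonneg ht
  obtain ⟨kε, hkε⟩ := eventually_atTop.mp
    ((hcont _ _ (fun k => hΦact k _ (hθO k)) (ha.trunc N) hθ).2.eventually_lt_const
      (lt_add_of_pos_right _ (by positivity : 0 < ε / 2)))
  refine ⟨kε, fun k hk n Ls hLs θstar hθstar hmin => ?_⟩
  have hle := csInf_le hbelow ⟨_, hΦact k _ hθstar, rfl⟩
  have hmain := le_add_two_mul_sSup_of_minimizer (S := O k) (w := fun θ => v (Φ k θ))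
    (g := fun θ => empLoss f x0 ψ φ (Φ k θ) Ls) (fun θ hθ => hvbound _ (hΦact k θ hθ))
    (fun θ hθ => abs_inv_card_mul_sum_le hcstar fun i => hbound _ _ (hΦact k θ hθ) (hLs i))
    hθstar hmin (hθO k)
  have hk' := hkε k hk
  rw [abs_sub_comm, abs_of_nonneg (sub_nonneg.mpr hle)]
  simp only [hv] at *
  linarith

end Overlearning
end
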